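/- arXiv:2308.05299 — 2 statements merged into one kernel-verified Lean document; each statement's English description precedes it below -/
import Mathlib

section
/- Let R be a G-graded domain that is a graded perinormal domain. Then R is a graded globally perinormal domain if and only if every graded overring of R that is flat as an R-module is a localization of R. -/
/-! Core definitions for graded perinormality, following Epstein–Shapiro style graded notions. -/

section Core

variable {ι : Type*} [DecidableEq ι] [AddCommMonoid ι]
variable {R : Type*} [CommRing R]

/-- `𝒜` is a grading of the ring `R` by the (torsionless) monoid `ι`:
the components multiply correctly and give an internal direct sum decomposition. -/
structure IsGrRing (𝒜 : ι → AddSubgroup R) : Prop where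
  one_mem : (1 : R) ∈ 𝒜 0
  mul_mem : ∀ {i j : ι} {a b : R}, a ∈ 𝒜 i → b ∈ 𝒜 j → a * b ∈ 𝒜 (i + j)
  internal : DirectSum.IsInternal 𝒜

/-- An ideal of `R` is homogeneous iff every element of it is a finite sum of
homogeneous elements of the ideal. -/
def IsHomIdeal (𝒜 : ι → AddSubgroup R) (I : Ideal R) : Prop :=
  ∀ x ∈ I, x ∈ AddSubmonoid.closure {y : R | SetLike.IsHomogeneousElem 𝒜 y ∧ y ∈ I}

/-- A graded (homogeneous) maximal ideal: maximal among proper homogeneous ideals. -/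
def IsGrMaxIdeal (𝒜 : ι → AddSubgroup R) (I : Ideal R) : Prop :=
  IsHomIdeal 𝒜 I ∧ I ≠ ⊤ ∧ ∀ J : Ideal R, IsHomIdeal 𝒜 J → I ≤ J → J ≠ ⊤ → J = I

/-- `R` is gr-local: it has exactly one graded maximal ideal. -/
def GrLocal (𝒜 : ι → AddSubgroup R) : Prop :=
  ∃! I : Ideal R, IsGrMaxIdeal 𝒜 I

/-- A prime ideal of height one (in a domain). -/
def HeightOnePrime (P : Ideal R) : Prop :=
  P.IsPrime ∧ P ≠ ⊥ ∧ ∀ Q : Ideal R, Q.IsPrime → Q < P → Q = ⊥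

variable [IsDomain R]

/-- A homogeneous element of the graded quotient field of `R`, i.e. a quotient of two
homogeneous elements of `R` (viewed inside the full quotient field). -/
def IsHomFrac (𝒜 : ι → AddSubgroup R) (x : FractionRing R) : Prop :=
  ∃ (i j : ι) (a b : R), a ∈ 𝒜 i ∧ b ∈ 𝒜 j ∧ b ≠ 0 ∧
    x * algebraMap R (FractionRing R) b = algebraMap R (FractionRing R) a

/-- `S` is a graded overring of `R`: a ring between `R` and the graded quotient field that is
the sum of its homogeneous components, i.e. each of its elements is a finite sum of
homogeneous elements of `S`. -/
def IsGradedOverring (𝒜 : ι → AddSubgroup R) (S : Subalgebra R (FractionRing R)) : Prop :=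
  ∀ x ∈ S, x ∈ AddSubmonoid.closure {y : FractionRing R | y ∈ S ∧ IsHomFrac 𝒜 y}

/-- A homogeneous ideal of an overring `S` of `R`. -/
def IsHomIdealOver (𝒜 : ι → AddSubgroup R) (S : Subalgebra R (FractionRing R))
    (I : Ideal S) : Prop :=
  ∀ x ∈ I, (x : FractionRing R) ∈ AddSubmonoid.closure
    {y : FractionRing R | IsHomFrac 𝒜 y ∧ ∃ h : y ∈ S, (⟨y, h⟩ : S) ∈ I}

/-- A graded maximal ideal of an overring. -/
def IsGrMaxIdealOver (𝒜 : ι → AddSubgroup R) (S : Subalgebra R (FractionRing R))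
    (I : Ideal S) : Prop :=
  IsHomIdealOver 𝒜 S I ∧ I ≠ ⊤ ∧
    ∀ J : Ideal S, IsHomIdealOver 𝒜 S J → I ≤ J → J ≠ ⊤ → J = I

/-- The overring `S` is gr-local. -/
def GrLocalOver (𝒜 : ι → AddSubgroup R) (S : Subalgebra R (FractionRing R)) : Prop :=
  ∃! I : Ideal S, IsGrMaxIdealOver 𝒜 S I

/-- `S` satisfies graded going-down (gGD) over `R`. -/
def GGD (𝒜 : ι → AddSubgroup R) (S : Subalgebra R (FractionRing R)) : Prop :=
  ∀ (P Q : Ideal R) (Qt : Ideal S), P.IsPrime → Q.IsPrime → Qt.IsPrime →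
    IsHomIdeal 𝒜 P → IsHomIdeal 𝒜 Q → IsHomIdealOver 𝒜 S Qt → P ≤ Q →
    Qt.comap (algebraMap R S) = Q →
    ∃ Pt : Ideal S, Pt.IsPrime ∧ IsHomIdealOver 𝒜 S Pt ∧ Pt ≤ Qt ∧
      Pt.comap (algebraMap R S) = P

/-- The overring `S` is a localization of `R` (at some multiplicative subset `W` of `R`). -/
def IsLocalizationOfR (S : Subalgebra R (FractionRing R)) : Prop :=
  ∃ W : Submonoid R, (∀ w ∈ W, IsUnit (algebraMap R S w)) ∧
    ∀ s : S, ∃ (r w : R), w ∈ W ∧ s * algebraMap R S w = algebraMap R S r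

/-- `R` is a graded perinormal domain: every gr-local graded overring satisfying gGD is a
localization of `R`. -/
def GradedPerinormal (𝒜 : ι → AddSubgroup R) : Prop :=
  ∀ S : Subalgebra R (FractionRing R),
    IsGradedOverring 𝒜 S → GrLocalOver 𝒜 S → GGD 𝒜 S → IsLocalizationOfR S

/-- `R` is a graded globally perinormal domain: every graded overring satisfying gGD is a
localization of `R`. -/
def GradedGloballyPerinormal (𝒜 : ι → AddSubgroup R) : Prop :=
  ∀ S : Subalgebra R (FractionRing R),
    IsGradedOverring 𝒜 S → GGD 𝒜 S → IsLocalizationOfR S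

/-- The homogeneous localization `R_(P)` of `R` at an ideal `P`: the subring of the graded
quotient field consisting of fractions with homogeneous denominator outside `P`. -/
def HomLocR (𝒜 : ι → AddSubgroup R) (P : Ideal R) : Subalgebra R (FractionRing R) :=
  Algebra.adjoin R {x : FractionRing R | ∃ a w : R, SetLike.IsHomogeneousElem 𝒜 w ∧ w ∉ P ∧
    x * algebraMap R (FractionRing R) w = algebraMap R (FractionRing R) a}

/-- The homogeneous localization `S_(Q)` of an overring `S` at an ideal `Q` of `S`. -/
def HomLocOver (𝒜 : ι → AddSubgroup R) (S : Subalgebra R (FractionRing R)) (Q : Ideal S) :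
    Subalgebra R (FractionRing R) :=
  Algebra.adjoin R {x : FractionRing R | ∃ s w : S, IsHomFrac 𝒜 (w : FractionRing R) ∧
    w ∉ Q ∧ x * (w : FractionRing R) = (s : FractionRing R)}

/-- The localization `R_W` of `R` at a multiplicative set `W`, as a subring of the quotient
field. -/
def LocW (W : Submonoid R) : Subalgebra R (FractionRing R) :=
  Algebra.adjoin R {x : FractionRing R | ∃ r : R, ∃ w ∈ W,
    x * algebraMap R (FractionRing R) w = algebraMap R (FractionRing R) r}

/-- A subring `V` of the graded quotient field (containing `R`) is a gr-valuation domain: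
for every nonzero homogeneous `x` of the graded quotient field, `x ∈ V` or `x⁻¹ ∈ V`. -/
def GrValuation (𝒜 : ι → AddSubgroup R) (V : Subalgebra R (FractionRing R)) : Prop :=
  ∀ x : FractionRing R, x ≠ 0 → IsHomFrac 𝒜 x → x ∈ V ∨ x⁻¹ ∈ V

/-- `R` is a gr-(R₁) domain: the homogeneous localization at every height-one homogeneous
prime is a gr-valuation domain. -/
def GrR1 (𝒜 : ι → AddSubgroup R) : Prop :=
  ∀ P : Ideal R, HeightOnePrime P → IsHomIdeal 𝒜 P → GrValuation 𝒜 (HomLocR 𝒜 P)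

/-- The ideal `I` of `T` is the contraction of the ideal `J` of `S` (that is, `I = J ∩ T`
inside the common quotient field). -/
def Contracts (T S : Subalgebra R (FractionRing R)) (J : Ideal S) (I : Ideal T) : Prop :=
  ∀ x : FractionRing R,
    (∃ h : x ∈ T, (⟨x, h⟩ : T) ∈ I) ↔ (x ∈ T ∧ ∃ h : x ∈ S, (⟨x, h⟩ : S) ∈ J)

/-- `S` satisfies graded going-down over the intermediate ring `T`. -/
def GGDSub (𝒜 : ι → AddSubgroup R) (T S : Subalgebra R (FractionRing R)) : Prop :=
  ∀ (P Q : Ideal T) (Qt : Ideal S), P.IsPrime → Q.IsPrime → Qt.IsPrime →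
    IsHomIdealOver 𝒜 T P → IsHomIdealOver 𝒜 T Q → IsHomIdealOver 𝒜 S Qt → P ≤ Q →
    Contracts T S Qt Q →
    ∃ Pt : Ideal S, Pt.IsPrime ∧ IsHomIdealOver 𝒜 S Pt ∧ Pt ≤ Qt ∧ Contracts T S Pt P

/-- `S` is a localization of the intermediate ring `T` at a multiplicative subset of `T`. -/
def IsLocalizationOfSub (T S : Subalgebra R (FractionRing R)) : Prop :=
  ∃ W : Submonoid (FractionRing R), (W : Set (FractionRing R)) ⊆ T ∧
    (∀ w ∈ W, ∃ y ∈ S, w * y = 1) ∧ ∀ s ∈ S, ∃ t ∈ T, ∃ w ∈ W, s * w = t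

/-- The intermediate ring `T` (e.g. a homogeneous localization of `R`) is a graded
perinormal domain. -/
def GradedPerinormalSub (𝒜 : ι → AddSubgroup R) (T : Subalgebra R (FractionRing R)) : Prop :=
  ∀ S : Subalgebra R (FractionRing R), T ≤ S → IsGradedOverring 𝒜 S → GrLocalOver 𝒜 S →
    GGDSub 𝒜 T S → IsLocalizationOfSub T S

/-- The intermediate ring `T` is a graded globally perinormal domain. -/
def GradedGloballyPerinormalSub (𝒜 : ι → AddSubgroup R)
    (T : Subalgebra R (FractionRing R)) : Prop :=
  ∀ S : Subalgebra R (FractionRing R), T ≤ S → IsGradedOverring 𝒜 S →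
    GGDSub 𝒜 T S → IsLocalizationOfSub T S

/-- `R` is a gr-essential domain: `R` is the intersection of homogeneous localizations at a
family of homogeneous primes, each of which is a gr-valuation domain. -/
def GrEssential (𝒜 : ι → AddSubgroup R) : Prop :=
  ∃ I : Set (Ideal R),
    (∀ P ∈ I, P.IsPrime ∧ IsHomIdeal 𝒜 P ∧ GrValuation 𝒜 (HomLocR 𝒜 P)) ∧
    ((⊥ : Subalgebra R (FractionRing R)) : Set (FractionRing R)) =
      ⋂ P ∈ I, (HomLocR 𝒜 P : Set (FractionRing R))

/-- The intermediate ring `T` is a gr-essential domain. -/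
def GrEssentialSub (𝒜 : ι → AddSubgroup R) (T : Subalgebra R (FractionRing R)) : Prop :=
  ∃ I : Set (Ideal T),
    (∀ P ∈ I, P.IsPrime ∧ IsHomIdealOver 𝒜 T P ∧ GrValuation 𝒜 (HomLocOver 𝒜 T P)) ∧
    (T : Set (FractionRing R)) = ⋂ P ∈ I, (HomLocOver 𝒜 T P : Set (FractionRing R))

end Core

section

variable {G : Type*} [AddCommGroup G]

theorem twoUniqueSums_of_not_isOfFinAddOrder (hG : ∀ g : G, g ≠ 0 → ¬IsOfFinAddOrder g) :
    TwoUniqueSums G := by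
  have : IsAddTorsionFree G := isAddTorsionFree_iff_not_isOfFinAddOrder.2 hG
  exact TwoUniqueSums.of_injective_addHom (DivisibleHull.coeAddMonoidHom G).toAddHom
    DivisibleHull.coe_injective inferInstance

/-- The map `S[G] → S` summing all coefficients. -/
noncomputable def coeffSum (G : Type*) [AddCommGroup G] (S : Type*) [CommRing S] :
    AddMonoidAlgebra S G →ₐ[S] S :=
  AddMonoidAlgebra.lift S S G 1

theorem coeffSum_apply {S : Type*} [CommRing S] (f : AddMonoidAlgebra S G) :
    coeffSum G S f = ∑ g ∈ f.coeff.support, f.coeff g := by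
  simp [coeffSum, AddMonoidAlgebra.lift_apply, Finsupp.sum]

theorem coeffSum_mapRingHom {S T : Type*} [CommRing S] [CommRing T] (φ : S →+* T)
    (f : AddMonoidAlgebra S G) :
    coeffSum G T (AddMonoidAlgebra.mapRingHom G φ f) = φ (coeffSum G S f) := by
  induction f using AddMonoidAlgebra.induction_linear with
  | zero => simp
  | add f f' hf hf' => simp only [map_add, hf, hf']
  | single g s => simp [coeffSum]

end

section

variable {G : Type*} {R : Type*} [CommRing R] {𝒜 : G → AddSubgroup R}
  {S : Subalgebra R (FractionRing R)}

theorem IsHomFrac.inv [IsDomain R] {x : FractionRing R} (hx : IsHomFrac 𝒜 x) :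
    IsHomFrac 𝒜 x⁻¹ := by
  rcases eq_or_ne x 0 with rfl | hx0
  · simpa using hx
  obtain ⟨i, j, a, b, ha, hb, hb0, h⟩ := hx
  have hb0' : algebraMap R (FractionRing R) b ≠ 0 := by simpa using hb0
  refine ⟨j, i, b, a, hb, ha, ?_, ?_⟩
  · rintro rfl
    simp_all
  · rw [← h, inv_mul_cancel_left₀ hx0]

theorem isGradedOverring_iff_isHomIdealOver_top :
    IsGradedOverring 𝒜 S ↔ IsHomIdealOver 𝒜 S ⊤ := by
  simp [IsGradedOverring, IsHomIdealOver, and_comm]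

/-- The ideal generated by the homogeneous elements of `I`. -/
def homCore (𝒜 : G → AddSubgroup R) (I : Ideal S) : Ideal S :=
  Ideal.span {s | IsHomFrac 𝒜 (s : FractionRing R) ∧ s ∈ I}

theorem homCore_le (I : Ideal S) : homCore 𝒜 I ≤ I :=
  Ideal.span_le.2 fun _ h ↦ h.2

theorem IsHomIdealOver.le_of_forall_isHomFrac {I J : Ideal S}
    (hI : IsHomIdealOver 𝒜 S I) (h : ∀ s ∈ I, IsHomFrac 𝒜 (s : FractionRing R) → s ∈ J) :
    I ≤ J := by
  have key : ∀ t ∈ AddSubmonoid.closure {y : FractionRing R | IsHomFrac 𝒜 y ∧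
      ∃ h : y ∈ S, (⟨y, h⟩ : S) ∈ I}, ∃ h : t ∈ S, (⟨t, h⟩ : S) ∈ J := by
    intro t ht
    induction ht using AddSubmonoid.closure_induction with
    | mem t ht => exact ⟨ht.2.1, h _ ht.2.2 ht.1⟩
    | zero => exact ⟨zero_mem _, zero_mem J⟩
    | add t u _ _ ht hu => exact ⟨add_mem ht.1 hu.1, add_mem ht.2 hu.2⟩
  exact fun s hs ↦ (key s (hI s hs)).2

theorem IsHomIdealOver.mem_closure_of_le {I J : Ideal S} (hI : IsHomIdealOver 𝒜 S I)
    (hIJ : I ≤ J) {x : S} (hx : x ∈ I) : (x : FractionRing R) ∈ AddSubmonoid.closure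
      {y : FractionRing R | IsHomFrac 𝒜 y ∧ ∃ h : y ∈ S, (⟨y, h⟩ : S) ∈ J} :=
  AddSubmonoid.closure_mono (by rintro y ⟨hy, hyS, hyI⟩; exact ⟨hy, hyS, hIJ hyI⟩) (hI x hx)

theorem exists_le_isGrMaxIdealOver {I : Ideal S}
    (hI : IsHomIdealOver 𝒜 S I) (hI' : I ≠ ⊤) : ∃ Q, IsGrMaxIdealOver 𝒜 S Q ∧ I ≤ Q := by
  obtain ⟨Q, hIQ, hQ⟩ := zorn_le_nonempty₀ {J : Ideal S | IsHomIdealOver 𝒜 S J ∧ J ≠ ⊤}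
    (fun c hc hchain J hJ ↦ by
      have hdir : DirectedOn (· ≤ ·) c := hchain.directedOn
      refine ⟨sSup c, ⟨fun x hx ↦ ?_, fun h ↦ ?_⟩, fun _ ↦ le_sSup⟩
      · obtain ⟨K, hK, hxK⟩ := (Submodule.mem_sSup_of_directed ⟨J, hJ⟩ hdir).1 hx
        exact (hc hK).1.mem_closure_of_le (le_sSup hK) hxK
      · rw [Ideal.eq_top_iff_one] at h
        obtain ⟨K, hK, hxK⟩ := (Submodule.mem_sSup_of_directed ⟨J, hJ⟩ hdir).1 h
        exact (hc hK).2 ((Ideal.eq_top_iff_one K).2 hxK)) I ⟨hI, hI'⟩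
  exact ⟨Q, ⟨hQ.prop.1, hQ.prop.2, fun J hJ hQJ hJ' ↦ (hQ.eq_of_le ⟨hJ, hJ'⟩ hQJ).symm⟩, hIQ⟩

/-- The ring of fractions `W⁻¹S` as an overring of `R`. -/
def fractionOverring (W : Submonoid S) :
    Subalgebra R (FractionRing R) where
  carrier := {x | ∃ s : S, ∃ w ∈ W, x * (w : FractionRing R) = s}
  mul_mem' := by
    rintro x y ⟨s, w, hw, h⟩ ⟨s', w', hw', h'⟩
    refine ⟨s * s', w * w', mul_mem hw hw', ?_⟩
    push_cast
    rw [← h, ← h']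
    ring
  add_mem' := by
    rintro x y ⟨s, w, hw, h⟩ ⟨s', w', hw', h'⟩
    refine ⟨s * w' + s' * w, w * w', mul_mem hw hw', ?_⟩
    push_cast
    rw [← h, ← h']
    ring
  algebraMap_mem' r := ⟨algebraMap R S r, 1, one_mem W, by simp⟩

theorem le_fractionOverring (W : Submonoid S) :
    S ≤ fractionOverring W :=
  fun s hs ↦ ⟨⟨s, hs⟩, 1, one_mem W, by simp⟩

/-- The extension of an ideal `I` of `S` to `W⁻¹S`. -/
def fractionIdeal (W : Submonoid S) (I : Ideal S) :
    Ideal (fractionOverring W) where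
  carrier := {x | ∃ s ∈ I, ∃ w ∈ W, (x : FractionRing R) * (w : FractionRing R) = s}
  zero_mem' := ⟨0, zero_mem I, 1, one_mem W, by simp⟩
  add_mem' := by
    rintro x y ⟨s, hs, w, hw, h⟩ ⟨s', hs', w', hw', h'⟩
    refine ⟨w' * s + w * s', add_mem (I.mul_mem_left _ hs) (I.mul_mem_left _ hs'), w * w',
      mul_mem hw hw', ?_⟩
    push_cast
    rw [← h, ← h']
    ring
  smul_mem' := by
    rintro ⟨x, s, w, hw, h⟩ y ⟨s', hs', w', hw', h'⟩
    refine ⟨s * s', I.mul_mem_left _ hs', w * w', mul_mem hw hw', ?_⟩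
    simp only [smul_eq_mul]
    push_cast
    rw [← h, ← h']
    ring

theorem inclusion_mem_fractionIdeal {W : Submonoid S}
    {I : Ideal S} {s : S} (hs : s ∈ I) :
    Subalgebra.inclusion (le_fractionOverring W) s ∈ fractionIdeal W I :=
  ⟨s, hs, 1, one_mem W, by simp⟩

theorem mem_of_inclusion_mem_fractionIdeal {W : Submonoid S}
    {I : Ideal S} (hI : ∀ s, ∀ w ∈ W, s * w ∈ I → s ∈ I) {s : S}
    (hs : Subalgebra.inclusion (le_fractionOverring W) s ∈ fractionIdeal W I) : s ∈ I := by
  obtain ⟨t, ht, w, hw, h⟩ := hs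
  refine hI s w hw ?_
  rwa [show s * w = t from Subtype.ext h]

theorem fractionIdeal_isPrime {W : Submonoid S}
    {I : Ideal S} (hI : I.IsPrime) (hIW : ∀ w ∈ W, w ∉ I) : (fractionIdeal W I).IsPrime := by
  have hI' : ∀ s, ∀ w ∈ W, s * w ∈ I → s ∈ I :=
    fun s w hw h ↦ (hI.mem_or_mem h).resolve_right (hIW w hw)
  refine ⟨fun h ↦ hI.ne_top ?_, ?_⟩
  · rw [Ideal.eq_top_iff_one] at h ⊢
    exact mem_of_inclusion_mem_fractionIdeal hI' (by simpa using h)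
  · rintro ⟨x, s, w, hw, h⟩ ⟨y, s', w', hw', h'⟩ ⟨t, ht, v, hv, h''⟩
    have : s * s' ∈ I := by
      refine hI' _ v hv ?_
      have : s * s' * v = w * w' * t := by
        apply Subtype.ext
        push_cast at h'' ⊢
        rw [← h, ← h', ← h'']
        ring
      rw [this]
      exact I.mul_mem_left _ ht
    exact (hI.mem_or_mem this).imp (fun hs ↦ ⟨s, hs, w, hw, h⟩) (fun hs ↦ ⟨s', hs, w', hw', h'⟩)

end

section GradedOverring

variable {G : Type*} [DecidableEq G] [AddCommGroup G] {R : Type*} [CommRing R] [IsDomain R]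
  {𝒜 : G → AddSubgroup R}

/-! ### Homogeneous fractions -/

theorem isHomFrac_algebraMap (hGr : IsGrRing 𝒜) {i : G} {a : R} (ha : a ∈ 𝒜 i) :
    IsHomFrac 𝒜 (algebraMap R (FractionRing R) a) :=
  ⟨i, 0, a, 1, ha, hGr.one_mem, one_ne_zero, by simp⟩

theorem isHomFrac_one (hGr : IsGrRing 𝒜) : IsHomFrac 𝒜 (1 : FractionRing R) := by
  simpa using isHomFrac_algebraMap hGr hGr.one_mem

theorem IsHomFrac.mul (hGr : IsGrRing 𝒜) {x y : FractionRing R} (hx : IsHomFrac 𝒜 x)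
    (hy : IsHomFrac 𝒜 y) : IsHomFrac 𝒜 (x * y) := by
  obtain ⟨i, j, a, b, ha, hb, hb0, h⟩ := hx
  obtain ⟨i', j', a', b', ha', hb', hb0', h'⟩ := hy
  refine ⟨_, _, _, _, hGr.mul_mem ha ha', hGr.mul_mem hb hb', mul_ne_zero hb0 hb0', ?_⟩
  rw [map_mul, map_mul, ← h, ← h']
  ring

/-- The degree `g` component of the graded quotient field of `R`. -/
def homFracComponent (hGr : IsGrRing 𝒜) (g : G) : AddSubgroup (FractionRing R) where
  carrier := {x | ∃ (j : G) (a b : R), a ∈ 𝒜 (g + j) ∧ b ∈ 𝒜 j ∧ b ≠ 0 ∧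
    x * algebraMap R (FractionRing R) b = algebraMap R (FractionRing R) a}
  zero_mem' := ⟨0, 0, 1, zero_mem _, hGr.one_mem, one_ne_zero, by simp⟩
  add_mem' := by
    rintro x y ⟨j, a, b, ha, hb, hb0, h⟩ ⟨j', a', b', ha', hb', hb0', h'⟩
    refine ⟨j + j', a * b' + a' * b, b * b', add_mem ?_ ?_, hGr.mul_mem hb hb',
      mul_ne_zero hb0 hb0', ?_⟩
    · simpa [add_assoc] using hGr.mul_mem ha hb'
    · simpa [add_assoc, add_comm j] using hGr.mul_mem ha' hb
    · simp only [map_mul, map_add, ← h, ← h']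
      ring
  neg_mem' := by
    rintro x ⟨j, a, b, ha, hb, hb0, h⟩
    exact ⟨j, -a, b, neg_mem ha, hb, hb0, by simp [h]⟩

theorem isHomFrac_iff_exists_mem (hGr : IsGrRing 𝒜) {x : FractionRing R} :
    IsHomFrac 𝒜 x ↔ ∃ g, x ∈ homFracComponent hGr g := by
  constructor
  · rintro ⟨i, j, a, b, ha, hb, hb0, h⟩
    exact ⟨i - j, j, a, b, by simpa using ha, hb, hb0, h⟩
  · rintro ⟨g, j, a, b, ha, hb, hb0, h⟩
    exact ⟨g + j, j, a, b, ha, hb, hb0, h⟩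

theorem mul_mem_homFracComponent (hGr : IsGrRing 𝒜) {g g' : G} {x y : FractionRing R}
    (hx : x ∈ homFracComponent hGr g) (hy : y ∈ homFracComponent hGr g') :
    x * y ∈ homFracComponent hGr (g + g') := by
  obtain ⟨j, a, b, ha, hb, hb0, h⟩ := hx
  obtain ⟨j', a', b', ha', hb', hb0', h'⟩ := hy
  refine ⟨j + j', a * a', b * b', ?_, hGr.mul_mem hb hb', mul_ne_zero hb0 hb0', ?_⟩
  · simpa [add_add_add_comm] using hGr.mul_mem ha ha'
  · rw [map_mul, map_mul, ← h, ← h']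
    ring

theorem exists_common_homogeneous_denominator (hGr : IsGrRing 𝒜) {f : G → FractionRing R}
    (hf : ∀ g, f g ∈ homFracComponent hGr g) (s : Finset G) :
    ∃ (e : G) (d : R), d ∈ 𝒜 e ∧ d ≠ 0 ∧ ∀ g ∈ s, ∃ a ∈ 𝒜 (g + e),
      f g * algebraMap R (FractionRing R) d = algebraMap R (FractionRing R) a := by
  induction s using Finset.induction_on with
  | empty => exact ⟨0, 1, hGr.one_mem, one_ne_zero, by simp⟩
  | insert g s hg ih =>
    obtain ⟨e, d, hd, hd0, H⟩ := ih
    obtain ⟨j, a, b, ha, hb, hb0, h⟩ := hf g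
    refine ⟨e + j, d * b, hGr.mul_mem hd hb, mul_ne_zero hd0 hb0, fun k hk ↦ ?_⟩
    rcases Finset.mem_insert.1 hk with rfl | hk
    · refine ⟨a * d, by simpa [add_assoc, add_comm e] using hGr.mul_mem ha hd, ?_⟩
      rw [map_mul, map_mul, ← h]
      ring
    · obtain ⟨c, hc, h'⟩ := H k hk
      refine ⟨c * b, by simpa [add_assoc] using hGr.mul_mem hc hb, ?_⟩
      rw [map_mul, map_mul, ← h']
      ring

theorem eq_zero_of_sum_homFracComponent_eq_zero (hGr : IsGrRing 𝒜) {f : G → FractionRing R}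
    (hf : ∀ g, f g ∈ homFracComponent hGr g) {s : Finset G} (hs : ∑ g ∈ s, f g = 0)
    {g : G} (hg : g ∈ s) : f g = 0 := by
  obtain ⟨e, d, hd, hd0, H⟩ := exists_common_homogeneous_denominator hGr hf s
  have H' : ∀ g, ∃ a : 𝒜 (g + e), g ∈ s →
      f g * algebraMap R (FractionRing R) d = algebraMap R (FractionRing R) a := by
    intro g
    by_cases hg : g ∈ s
    · obtain ⟨a, ha, h⟩ := H g hg
      exact ⟨⟨a, ha⟩, fun _ ↦ h⟩
    · exact ⟨0, fun h ↦ absurd h hg⟩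
  choose a ha using H'
  have hsum : ∑ g ∈ s, DirectSum.of (fun i ↦ 𝒜 i) (g + e) (a g) = 0 := by
    apply hGr.internal.injective
    apply IsFractionRing.injective R (FractionRing R)
    simp only [map_sum, DirectSum.coeAddMonoidHom_of, map_zero]
    rw [← Finset.sum_congr rfl (fun g hg ↦ ha g hg), ← Finset.sum_mul, hs, zero_mul]
  have h0 : a g = 0 := by
    have := DFunLike.congr_fun hsum (g + e)
    rw [DirectSum.sum_apply, Finset.sum_eq_single_of_mem g hg] at this
    · rwa [DirectSum.of_eq_same] at this
    · intro k _ hk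
      exact DirectSum.of_eq_of_ne _ _ _ (by simpa using hk.symm)
  have h1 := ha g hg
  rw [h0] at h1
  simpa [hd0] using h1

/-! ### Homogeneous decompositions in a graded overring -/

/-- The elements of the group algebra `S[G]` whose coefficient at `g` has degree `g`. -/
def homogeneousGroupAlgebra (hGr : IsGrRing 𝒜) (S : Subalgebra R (FractionRing R)) :
    AddSubgroup (AddMonoidAlgebra S G) where
  carrier := {f | ∀ g, (f.coeff g : FractionRing R) ∈ homFracComponent hGr g}
  zero_mem' _ := zero_mem _
  add_mem' hf hf' g := add_mem (hf g) (hf' g)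
  neg_mem' hf g := neg_mem (hf g)

theorem single_mem_homogeneousGroupAlgebra (hGr : IsGrRing 𝒜) {S : Subalgebra R (FractionRing R)}
    {g : G} {s : S} (hs : (s : FractionRing R) ∈ homFracComponent hGr g) :
    AddMonoidAlgebra.single g s ∈ homogeneousGroupAlgebra hGr S := by
  intro k
  rw [AddMonoidAlgebra.coeff_single, Finsupp.single_apply]
  split_ifs with h
  · exact h ▸ hs
  · exact zero_mem _

theorem mul_mem_homogeneousGroupAlgebra (hGr : IsGrRing 𝒜) {S : Subalgebra R (FractionRing R)}
    {f f' : AddMonoidAlgebra S G} (hf : f ∈ homogeneousGroupAlgebra hGr S)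
    (hf' : f' ∈ homogeneousGroupAlgebra hGr S) : f * f' ∈ homogeneousGroupAlgebra hGr S := by
  rw [AddMonoidAlgebra.mul_def]
  exact sum_mem fun i _ ↦ sum_mem fun j _ ↦
    single_mem_homogeneousGroupAlgebra hGr (mul_mem_homFracComponent hGr (hf i) (hf' j))

theorem coeffSum_injOn (hGr : IsGrRing 𝒜) (S : Subalgebra R (FractionRing R)) :
    Set.InjOn (coeffSum G S) (homogeneousGroupAlgebra hGr S) := by
  intro f hf f' hf' h
  rw [← sub_eq_zero] at h ⊢
  rw [← map_sub, coeffSum_apply] at h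
  have hmem := sub_mem hf hf'
  ext g
  by_cases hg : g ∈ (f - f').coeff.support
  · exact eq_zero_of_sum_homFracComponent_eq_zero hGr
      (f := fun g ↦ ((f - f').coeff g : FractionRing R)) hmem
      (by simpa using congrArg (Subtype.val) h) hg
  · exact congrArg Subtype.val (Finsupp.notMem_support_iff.1 hg)

theorem exists_homogeneousGroupAlgebra_coeffSum_eq (hGr : IsGrRing 𝒜)
    {S : Subalgebra R (FractionRing R)} {p : S → Prop} {x : FractionRing R}
    (hx : x ∈ AddSubmonoid.closure {y : FractionRing R | IsHomFrac 𝒜 y ∧ ∃ h : y ∈ S, p ⟨y, h⟩})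
    (I : Ideal S) (hp : ∀ s, p s → s ∈ I) :
    ∃ f ∈ homogeneousGroupAlgebra hGr S, (coeffSum G S f : FractionRing R) = x ∧
      ∀ g, f.coeff g ∈ I := by
  induction hx using AddSubmonoid.closure_induction with
  | mem y hy =>
    obtain ⟨hy, hyS, hyp⟩ := hy
    obtain ⟨g, hg⟩ := (isHomFrac_iff_exists_mem hGr).1 hy
    refine ⟨AddMonoidAlgebra.single g ⟨y, hyS⟩, single_mem_homogeneousGroupAlgebra hGr hg,
      by simp [coeffSum], fun k ↦ ?_⟩
    rw [AddMonoidAlgebra.coeff_single, Finsupp.single_apply]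
    split_ifs with h
    · exact hp _ hyp
    · exact zero_mem _
  | zero => exact ⟨0, zero_mem _, by simp, fun g ↦ zero_mem _⟩
  | add y z _ _ hy hz =>
    obtain ⟨f, hf, h1, h2⟩ := hy
    obtain ⟨f', hf', h1', h2'⟩ := hz
    exact ⟨f + f', add_mem hf hf', by simp [h1, h1'], fun g ↦ add_mem (h2 g) (h2' g)⟩

/-! ### Homogeneous ideals of a graded overring -/

theorem isHomIdealOver_span (hGr : IsGrRing 𝒜) {S : Subalgebra R (FractionRing R)}
    (hS : IsGradedOverring 𝒜 S) {A : Set S} (hA : ∀ a ∈ A, IsHomFrac 𝒜 (a : FractionRing R)) :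
    IsHomIdealOver 𝒜 S (Ideal.span A) := by
  intro x hx
  induction hx using Submodule.span_induction with
  | mem a ha => exact AddSubmonoid.subset_closure ⟨hA a ha, a.2, Ideal.subset_span ha⟩
  | zero => exact zero_mem _
  | add y z _ _ hy hz => exact add_mem hy hz
  | smul s y _ hy =>
    have key : ∀ t ∈ AddSubmonoid.closure {y : FractionRing R | y ∈ S ∧ IsHomFrac 𝒜 y},
        t * (y : FractionRing R) ∈ AddSubmonoid.closure
          {y : FractionRing R | IsHomFrac 𝒜 y ∧ ∃ h : y ∈ S, (⟨y, h⟩ : S) ∈ Ideal.span A} := by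
      intro t ht
      generalize (y : FractionRing R) = y at hy
      induction hy using AddSubmonoid.closure_induction with
      | mem y hy =>
        obtain ⟨hy, hyS, hyA⟩ := hy
        induction ht using AddSubmonoid.closure_induction with
        | mem t ht =>
          exact AddSubmonoid.subset_closure ⟨ht.2.mul hGr hy, mul_mem ht.1 hyS,
            Ideal.mul_mem_left _ ⟨t, ht.1⟩ hyA⟩
        | zero => simp
        | add t u _ _ ht hu => simpa [add_mul] using add_mem ht hu
      | zero => simp
      | add y z _ _ hy hz => simpa [mul_add] using add_mem hy hz
    exact key s (hS s s.2)

theorem isHomIdealOver_homCore (hGr : IsGrRing 𝒜) {S : Subalgebra R (FractionRing R)}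
    (hS : IsGradedOverring 𝒜 S) (I : Ideal S) : IsHomIdealOver 𝒜 S (homCore 𝒜 I) :=
  isHomIdealOver_span hGr hS fun _ h ↦ h.1

theorem exists_homogeneousGroupAlgebra_coeffSum (hGr : IsGrRing 𝒜)
    {S : Subalgebra R (FractionRing R)} (hS : IsGradedOverring 𝒜 S) (s : S) :
    ∃ f ∈ homogeneousGroupAlgebra hGr S, coeffSum G S f = s := by
  obtain ⟨f, hf, h, -⟩ := exists_homogeneousGroupAlgebra_coeffSum_eq hGr
    (isGradedOverring_iff_isHomIdealOver_top.1 hS s Submodule.mem_top) ⊤ (by simp)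
  exact ⟨f, hf, Subtype.ext h⟩

theorem IsHomIdealOver.coeff_mem (hGr : IsGrRing 𝒜) {S : Subalgebra R (FractionRing R)}
    {I : Ideal S} (hI : IsHomIdealOver 𝒜 S I) {f : AddMonoidAlgebra S G}
    (hf : f ∈ homogeneousGroupAlgebra hGr S) (hfI : coeffSum G S f ∈ I) (g : G) :
    f.coeff g ∈ I := by
  obtain ⟨k, hk, hke, hkI⟩ := exists_homogeneousGroupAlgebra_coeffSum_eq hGr
    (hI _ hfI) I (fun s hs ↦ hs)
  rw [coeffSum_injOn hGr S hf hk (Subtype.ext hke.symm)]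
  exact hkI g

theorem homCore_isPrime (hG : ∀ g : G, g ≠ 0 → ¬IsOfFinAddOrder g) (hGr : IsGrRing 𝒜)
    {S : Subalgebra R (FractionRing R)} (hS : IsGradedOverring 𝒜 S) {P : Ideal S}
    (hP : P.IsPrime) : (homCore 𝒜 P).IsPrime := by
  have := twoUniqueSums_of_not_isOfFinAddOrder hG
  have hmem : ∀ f ∈ homogeneousGroupAlgebra hGr S,
      AddMonoidAlgebra.mapRingHom G (Ideal.Quotient.mk P) f = 0 →
        coeffSum G S f ∈ homCore 𝒜 P := by
    intro f hf h
    rw [coeffSum_apply]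
    refine sum_mem fun g _ ↦ Ideal.subset_span ⟨(isHomFrac_iff_exists_mem hGr).2 ⟨g, hf g⟩, ?_⟩
    rw [← Ideal.Quotient.eq_zero_iff_mem]
    simpa using congrArg (fun f ↦ f.coeff g) h
  refine ⟨ne_top_of_le_ne_top hP.ne_top (homCore_le P), fun {a b} hab ↦ ?_⟩
  obtain ⟨f, hf, rfl⟩ := exists_homogeneousGroupAlgebra_coeffSum hGr hS a
  obtain ⟨f', hf', rfl⟩ := exists_homogeneousGroupAlgebra_coeffSum hGr hS b
  have h0 : AddMonoidAlgebra.mapRingHom G (Ideal.Quotient.mk P) f *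
      AddMonoidAlgebra.mapRingHom G (Ideal.Quotient.mk P) f' = 0 := by
    rw [← map_mul]
    ext g
    rw [← map_mul] at hab
    have h := homCore_le P ((isHomIdealOver_homCore hGr hS P).coeff_mem hGr
      (mul_mem_homogeneousGroupAlgebra hGr hf hf') hab g)
    simpa [Ideal.Quotient.eq_zero_iff_mem, -map_mul] using h
  exact (mul_eq_zero.1 h0).imp (hmem f hf) (hmem f' hf')

/-! ### Flat graded overrings satisfy graded going-down -/

theorem ggd_of_flat (hG : ∀ g : G, g ≠ 0 → ¬IsOfFinAddOrder g) (hGr : IsGrRing 𝒜)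
    {S : Subalgebra R (FractionRing R)} (hS : IsGradedOverring 𝒜 S) [Module.Flat R S] :
    GGD 𝒜 S := by
  intro P Q Qt hP hQ hQt hPh hQh hQth hPQ hQtQ
  have : Qt.LiesOver Q := ⟨hQtQ.symm⟩
  obtain ⟨Pt, hle, hPt, hover⟩ := Qt.exists_ideal_le_liesOver_of_le (p := P) (q := Q) hPQ
  refine ⟨homCore 𝒜 Pt, homCore_isPrime hG hGr hS hPt, isHomIdealOver_homCore hGr hS Pt,
    (homCore_le Pt).trans hle, le_antisymm ?_ ?_⟩
  · rw [hover.over]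
    exact Ideal.comap_mono (homCore_le Pt)
  · intro x hx
    refine (AddSubmonoid.closure_le (S := ((homCore 𝒜 Pt).comap
      (algebraMap R S)).toAddSubmonoid)).2 ?_ (hPh x hx)
    rintro y ⟨⟨i, hi⟩, hy⟩
    rw [hover.over] at hy
    exact Ideal.subset_span ⟨isHomFrac_algebraMap hGr hi, hy⟩

/-! ### Rings of fractions of an overring -/

theorem isUnit_inclusion_fractionOverring {S : Subalgebra R (FractionRing R)} {W : Submonoid S}
    (hW0 : (0 : S) ∉ W) {w : S} (hw : w ∈ W) :
    IsUnit (Subalgebra.inclusion (le_fractionOverring W) w) := by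
  have hw0 : (w : FractionRing R) ≠ 0 := fun h ↦ hW0 ((Subtype.ext h : w = 0) ▸ hw)
  refine IsUnit.of_mul_eq_one ⟨(w : FractionRing R)⁻¹, 1, w, hw, ?_⟩ (Subtype.ext ?_)
  · simp [hw0]
  · exact mul_inv_cancel₀ hw0

theorem isHomIdealOver_fractionIdeal (hGr : IsGrRing 𝒜) {S : Subalgebra R (FractionRing R)}
    {W : Submonoid S} (hW0 : (0 : S) ∉ W) (hW : ∀ w ∈ W, IsHomFrac 𝒜 (w : FractionRing R))
    {I : Ideal S} (hI : IsHomIdealOver 𝒜 S I) :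
    IsHomIdealOver 𝒜 (fractionOverring W) (fractionIdeal W I) := by
  rintro x ⟨s, hs, w, hw, h⟩
  have hw0 : (w : FractionRing R) ≠ 0 := fun h ↦ hW0 ((Subtype.ext h : w = 0) ▸ hw)
  rw [(eq_mul_inv_iff_mul_eq₀ hw0).2 h]
  have hs' := hI s hs
  generalize (s : FractionRing R) = s at hs'
  induction hs' using AddSubmonoid.closure_induction with
  | mem t ht =>
    obtain ⟨ht, htS, htI⟩ := ht
    exact AddSubmonoid.subset_closure ⟨ht.mul hGr (hW w hw).inv,
      ⟨⟨t, htS⟩, w, hw, by simp [hw0]⟩, ⟨t, htS⟩, htI, w, hw, by simp [hw0]⟩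
  | zero => simp
  | add t u _ _ ht hu => simpa [add_mul] using add_mem ht hu

theorem isGradedOverring_fractionOverring (hGr : IsGrRing 𝒜) {S : Subalgebra R (FractionRing R)}
    (hS : IsGradedOverring 𝒜 S) {W : Submonoid S} (hW0 : (0 : S) ∉ W)
    (hW : ∀ w ∈ W, IsHomFrac 𝒜 (w : FractionRing R)) :
    IsGradedOverring 𝒜 (fractionOverring W) := by
  rw [isGradedOverring_iff_isHomIdealOver_top] at hS ⊢
  have h := isHomIdealOver_fractionIdeal hGr hW0 hW hS
  rwa [show fractionIdeal W ⊤ = ⊤ from (Ideal.eq_top_iff_one _).2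
    ⟨1, Submodule.mem_top, 1, one_mem W, by simp⟩] at h

theorem isHomIdealOver_comap_inclusion {S T : Subalgebra R (FractionRing R)}
    (hGr : IsGrRing 𝒜) (hS : IsGradedOverring 𝒜 S) (hST : S ≤ T) {I : Ideal T}
    (hI : IsHomIdealOver 𝒜 T I) :
    IsHomIdealOver 𝒜 S (I.comap (Subalgebra.inclusion hST)) := by
  intro x hx
  obtain ⟨f, hf, rfl⟩ := exists_homogeneousGroupAlgebra_coeffSum hGr hS x
  have hmem := hI.coeff_mem hGr (f := AddMonoidAlgebra.mapRingHom G
    (Subalgebra.inclusion hST).toRingHom f) (fun g ↦ by simpa using hf g)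
    (by rw [coeffSum_mapRingHom]; exact hx)
  rw [coeffSum_apply, AddSubmonoidClass.coe_finsetSum]
  refine sum_mem fun g _ ↦ AddSubmonoid.subset_closure
    ⟨(isHomFrac_iff_exists_mem hGr).2 ⟨g, hf g⟩, (f.coeff g).2, ?_⟩
  simpa using hmem g

/-! ### Graded maximal ideals -/

theorem IsGrMaxIdealOver.mul_notMem (hGr : IsGrRing 𝒜) {S : Subalgebra R (FractionRing R)}
    (hS : IsGradedOverring 𝒜 S) {Q : Ideal S} (hQ : IsGrMaxIdealOver 𝒜 S Q) {v w : S}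
    (hw : IsHomFrac 𝒜 (w : FractionRing R)) (hvQ : v ∉ Q) (hwQ : w ∉ Q) : v * w ∉ Q := by
  have htop : Q ⊔ Ideal.span {w} = ⊤ := by
    by_contra h
    have hhom : IsHomIdealOver 𝒜 S (Q ⊔ Ideal.span {w}) := by
      intro x hx
      obtain ⟨y, hy, z, hz, rfl⟩ := Submodule.mem_sup.1 hx
      exact add_mem (hQ.1.mem_closure_of_le le_sup_left hy)
        ((isHomIdealOver_span hGr hS (by simpa using hw)).mem_closure_of_le le_sup_right hz)
    have := hQ.2.2 _ hhom le_sup_left h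
    exact hwQ (this ▸ Ideal.mem_sup_right (Ideal.mem_span_singleton_self w))
  intro hvw
  obtain ⟨q, hq, z, hz, h1⟩ := Submodule.mem_sup.1 ((Ideal.eq_top_iff_one _).1 htop)
  obtain ⟨c, rfl⟩ := Ideal.mem_span_singleton'.1 hz
  refine hvQ ?_
  rw [show v = v * q + c * (v * w) by linear_combination (-v) * h1]
  exact add_mem (Q.mul_mem_left _ hq) (Q.mul_mem_left _ hvw)

/-- The multiplicative set of homogeneous elements outside a graded maximal ideal. -/
def homCompl (hGr : IsGrRing 𝒜) {S : Subalgebra R (FractionRing R)} (hS : IsGradedOverring 𝒜 S)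
    {Q : Ideal S} (hQ : IsGrMaxIdealOver 𝒜 S Q) : Submonoid S where
  carrier := {w | IsHomFrac 𝒜 (w : FractionRing R) ∧ w ∉ Q}
  one_mem' := ⟨isHomFrac_one hGr, fun h ↦ hQ.2.1 ((Ideal.eq_top_iff_one Q).2 h)⟩
  mul_mem' hv hw := ⟨hv.1.mul hGr hw.1, hQ.mul_notMem hGr hS hw.1 hv.2 hw.2⟩

theorem zero_notMem_homCompl (hGr : IsGrRing 𝒜) {S : Subalgebra R (FractionRing R)}
    (hS : IsGradedOverring 𝒜 S) {Q : Ideal S} (hQ : IsGrMaxIdealOver 𝒜 S Q) :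
    (0 : S) ∉ homCompl hGr hS hQ :=
  fun h ↦ h.2 (zero_mem Q)

theorem grLocalOver_fractionOverring (hGr : IsGrRing 𝒜) {S : Subalgebra R (FractionRing R)}
    (hS : IsGradedOverring 𝒜 S) {Q : Ideal S} (hQ : IsGrMaxIdealOver 𝒜 S Q) :
    GrLocalOver 𝒜 (fractionOverring (homCompl hGr hS hQ)) := by
  set W := homCompl hGr hS hQ
  have hW0 : (0 : S) ∉ W := zero_notMem_homCompl hGr hS hQ
  have hle : ∀ J : Ideal (fractionOverring W), IsHomIdealOver 𝒜 (fractionOverring W) J → J ≠ ⊤ →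
      J ≤ fractionIdeal W Q := by
    intro J hJ hJ'
    refine hJ.le_of_forall_isHomFrac ?_
    rintro ⟨x, s, w, hw, h⟩ hxJ hx
    refine ⟨s, ?_, w, hw, h⟩
    by_contra hs
    have hsW : s ∈ W := ⟨h ▸ hx.mul hGr hw.1, hs⟩
    refine hJ' (Ideal.eq_top_of_isUnit_mem _ ?_ (isUnit_inclusion_fractionOverring hW0 hsW))
    convert J.mul_mem_right (Subalgebra.inclusion (le_fractionOverring W) w) hxJ using 1
    exact Subtype.ext h.symm
  have hhom : IsHomIdealOver 𝒜 (fractionOverring W) (fractionIdeal W Q) :=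
    isHomIdealOver_fractionIdeal hGr hW0 (fun w hw ↦ hw.1) hQ.1
  have htop : fractionIdeal W Q ≠ ⊤ := by
    intro h
    obtain ⟨s, hs, w, hw, h⟩ := (Ideal.eq_top_iff_one _).1 h
    exact hw.2 (by rwa [show w = s from Subtype.ext (by simpa using h)])
  refine ⟨fractionIdeal W Q, ⟨hhom, htop, fun J hJ hQJ hJ' ↦ le_antisymm (hle J hJ hJ') hQJ⟩,
    fun J hJ ↦ ?_⟩
  exact (hJ.2.2 _ hhom (hle J hJ.1 hJ.2.1) htop).symm

theorem GGD.fractionOverring (hGr : IsGrRing 𝒜) {S : Subalgebra R (FractionRing R)}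
    (hS : IsGradedOverring 𝒜 S) (hgd : GGD 𝒜 S) {W : Submonoid S} (hW0 : (0 : S) ∉ W)
    (hW : ∀ w ∈ W, IsHomFrac 𝒜 (w : FractionRing R)) : GGD 𝒜 (fractionOverring W) := by
  intro P Q Qt hP hQ hQt hPh hQh hQth hPQ hQtQ
  let φ := (Subalgebra.inclusion (le_fractionOverring W)).toRingHom
  obtain ⟨Pt, hPt, hPth, hle, hover⟩ := hgd P Q (Qt.comap φ) hP hQ (hQt.comap φ) hPh hQh
    (isHomIdealOver_comap_inclusion hGr hS _ hQth) hPQ hQtQ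
  have hdisj : ∀ w ∈ W, w ∉ Pt := fun w hw hwP ↦
    hQt.ne_top (Ideal.eq_top_of_isUnit_mem _ (hle hwP) (isUnit_inclusion_fractionOverring hW0 hw))
  refine ⟨fractionIdeal W Pt, fractionIdeal_isPrime hPt hdisj,
    isHomIdealOver_fractionIdeal hGr hW0 hW hPth, ?_, ?_⟩
  · rintro ⟨x, hx⟩ ⟨s, hs, w, hw, h⟩
    obtain ⟨u, hu⟩ := isUnit_inclusion_fractionOverring hW0 hw
    refine (Ideal.mul_unit_mem_iff_mem Qt u.isUnit).1 ?_
    rw [hu, show (⟨x, hx⟩ : _root_.fractionOverring W) *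
      Subalgebra.inclusion (le_fractionOverring W) w = φ s from Subtype.ext h]
    exact hle hs
  · rw [← hover]
    ext r
    refine ⟨fun hr ↦ ?_, fun hr ↦ inclusion_mem_fractionIdeal (W := W)
      (hr : algebraMap R S r ∈ Pt)⟩
    exact mem_of_inclusion_mem_fractionIdeal (W := W)
      (fun s w hw h ↦ (hPt.mem_or_mem h).resolve_right (hdisj w hw)) hr

/-! ### A flatness criterion for overrings -/

/-- The ideal of all `r : R` with `r • s ∈ R`. -/
def denominatorIdeal {S : Subalgebra R (FractionRing R)} (s : S) : Ideal R :=
  (LinearMap.range (Algebra.linearMap R S)).comap (LinearMap.toSpanSingleton R S s)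

theorem flat_of_map_denominatorIdeal_eq_top {S : Subalgebra R (FractionRing R)}
    (h : ∀ s : S, (denominatorIdeal s).map (algebraMap R S) = ⊤) : Module.Flat R S := by
  refine Module.Flat.of_forall_isTrivialRelation fun {l f x} hfx ↦ ?_
  have htop : (∏ i, denominatorIdeal (x i)).map (algebraMap R S) = ⊤ := by
    rw [← Ideal.mapHom_apply, map_prod, ← Ideal.one_eq_top]
    exact Finset.prod_eq_one fun i _ ↦ (h (x i)).trans Ideal.one_eq_top.symm
  obtain ⟨n, y, j, hj⟩ := Submodule.mem_span_set'.1 ((Ideal.eq_top_iff_one _).1 htop)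
  choose d hd hdj using fun k ↦ (j k).2
  have hex : ∀ i k, ∃ a, algebraMap R S a = d k • x i := fun i k ↦
    (Ideal.prod_le_inf.trans (Finset.inf_le (Finset.mem_univ i))) (hd k)
  choose a ha using hex
  refine ⟨n, a, y, fun i ↦ ?_, fun k ↦ ?_⟩
  · rw [← one_mul (x i), ← hj, Finset.sum_mul]
    refine Finset.sum_congr rfl fun k _ ↦ ?_
    rw [Algebra.smul_def (a i k), ha, ← hdj, Algebra.smul_def (d k), smul_eq_mul]
    ring
  · apply FaithfulSMul.algebraMap_injective R S
    rw [map_sum, map_zero, ← smul_zero (d k), ← hfx, Finset.smul_sum]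
    refine Finset.sum_congr rfl fun i _ ↦ ?_
    rw [map_mul, ha, Algebra.smul_def, Algebra.smul_def, Algebra.smul_def]
    ring

theorem flat_of_ggd (hGr : IsGrRing 𝒜) (hperi : GradedPerinormal 𝒜)
    {S : Subalgebra R (FractionRing R)} (hS : IsGradedOverring 𝒜 S) (hgd : GGD 𝒜 S) :
    Module.Flat R S := by
  refine flat_of_map_denominatorIdeal_eq_top fun s ↦ ?_
  set I := (denominatorIdeal s).map (algebraMap R S)
  suffices h : homCore 𝒜 I = ⊤ from top_le_iff.1 (h ▸ homCore_le I)
  by_contra hne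
  obtain ⟨Q, hQ, hIQ⟩ := exists_le_isGrMaxIdealOver (isHomIdealOver_homCore hGr hS I) hne
  have hW0 := zero_notMem_homCompl hGr hS hQ
  obtain ⟨V, hV, hloc⟩ := hperi _ (isGradedOverring_fractionOverring hGr hS hW0 fun w hw ↦ hw.1)
    (grLocalOver_fractionOverring hGr hS hQ) (hgd.fractionOverring hGr hS hW0 fun w hw ↦ hw.1)
  obtain ⟨r, v, hv, hsv⟩ := hloc (Subalgebra.inclusion (le_fractionOverring _) s)
  obtain ⟨⟨y, t, w, hw, hyw⟩, hvy⟩ := (hV v hv).exists_right_inv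
  have hvI : algebraMap R S v ∈ I := by
    refine Ideal.mem_map_of_mem _ ⟨r, Subtype.ext ?_⟩
    simpa [Algebra.smul_def, mul_comm] using (congrArg Subtype.val hsv).symm
  have hwI : w ∈ I := by
    rw [show w = t * algebraMap R S v from Subtype.ext ?_]
    · exact I.mul_mem_left _ hvI
    · have hvy' : algebraMap R (FractionRing R) v * y = 1 := congrArg Subtype.val hvy
      change (w : FractionRing R) = t * algebraMap R (FractionRing R) v
      rw [← hyw]
      linear_combination (-(w : FractionRing R)) * hvy'
  exact hw.2 (hIQ (Ideal.subset_span ⟨hw.1, hwI⟩))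

end GradedOverring

/-- Let `R` be a `G`-graded domain that is graded perinormal. Then `R` is a
graded globally perinormal domain if and only if every graded overring of `R` that is flat as
an `R`-module is a localization of `R`. -/
theorem gradedGloballyPerinormal_iff_flat_loc
    {G : Type*} [DecidableEq G] [AddCommGroup G] (hG : ∀ g : G, g ≠ 0 → ¬IsOfFinAddOrder g)
    {R : Type*} [CommRing R] [IsDomain R]
    (𝒜 : G → AddSubgroup R) (hGr : IsGrRing 𝒜)
    (hperi : GradedPerinormal 𝒜) :
    GradedGloballyPerinormal 𝒜 ↔
      ∀ S : Subalgebra R (FractionRing R), IsGradedOverring 𝒜 S → Module.Flat R S →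
        IsLocalizationOfR S := by
  refine ⟨fun h S hS _ ↦ h S hS (ggd_of_flat hG hGr hS), fun h S hS hgd ↦ ?_⟩
  exact h S hS (flat_of_ggd hGr hperi hS hgd)
end

section
/- Let R be a G-graded domain whose integral closure R′ (in its quotient field) is a graded Krull domain, such that R is a gr-(R₁) domain and for every height-one homogeneous prime P of R′, the contraction P ∩ R is a height-one homogeneous prime of R. If there exists a graded maximal ideal 𝔪 of R such that 𝔭 ⊆ 𝔪 for every height-one homogeneous prime 𝔭 of R, then R is gr-local. -/
/-- The localization of `R` at a prime `P`, realized as a subring of the quotient field. -/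
def LocAt {R : Type*} [CommRing R] [IsDomain R] (P : Ideal R) :
    Subalgebra R (FractionRing R) :=
  Algebra.adjoin R {x : FractionRing R | ∃ a w : R, w ∉ P ∧
    x * algebraMap R (FractionRing R) w = algebraMap R (FractionRing R) a}

/-- A Krull domain: the localizations at the height-one primes are discrete valuation rings,
`R` is the intersection of these localizations, and every nonzero element lies in only
finitely many height-one primes. -/
def IsKrullDomainDef (R : Type*) [CommRing R] [IsDomain R] : Prop :=
  (∀ P : Ideal R, HeightOnePrime P → IsDiscreteValuationRing (LocAt P)) ∧
  (((⊥ : Subalgebra R (FractionRing R)) : Set (FractionRing R)) =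
    ⋂ P ∈ {P : Ideal R | HeightOnePrime P}, (LocAt P : Set (FractionRing R))) ∧
  (∀ x : R, x ≠ 0 → {P : Ideal R | HeightOnePrime P ∧ x ∈ P}.Finite)

section Helpers

/-- A torsion-free abelian group admits a compatible linear order, and the equality test of that
order may be prescribed. -/
theorem exists_linearOrder_isOrderedCancelAddMonoid (G : Type*) [inst : DecidableEq G]
    [AddCommGroup G] [IsAddTorsionFree G] :
    ∃ o : LinearOrder G, o.toDecidableEq = inst ∧ IsOrderedCancelAddMonoid G := by
  classical
  let b := Module.Basis.ofVectorSpace ℚ (DivisibleHull G)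
  let : LinearOrder (Module.Basis.ofVectorSpaceIndex ℚ (DivisibleHull G)) :=
    linearOrderOfSTO WellOrderingRel
  let f : G → Lex (Module.Basis.ofVectorSpaceIndex ℚ (DivisibleHull G) →₀ ℚ) :=
    fun g => toLex (b.repr (g : DivisibleHull G))
  have hf : Function.Injective f := fun x y h =>
    DivisibleHull.coe_injective (b.repr.injective (toLex.injective h))
  have hadd : ∀ x y, f (x + y) = f x + f y := fun x y => by
    simp [f, DivisibleHull.coe_add]
  let o : LinearOrder G := LinearOrder.lift' f hf
  have hle : ∀ x y : G, x ≤ y ↔ f x ≤ f y := fun _ _ => Iff.rfl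
  refine ⟨o, Subsingleton.elim _ _, ?_⟩
  exact
    { add_le_add_left := fun x y h z => by
        rw [hle] at h ⊢
        rw [hadd, hadd]
        exact add_le_add_left h _
      le_of_add_le_add_left := fun x y z h => by
        rw [hle] at h ⊢
        rw [hadd, hadd] at h
        exact le_of_add_le_add_left h }

variable {G : Type*} [DecidableEq G] [AddCommGroup G]
variable {R : Type*} [CommRing R]
variable {𝒜 : G → AddSubgroup R}

/-- In a graded ring, homogeneous elements of distinct degrees summing to zero all vanish. -/
theorem IsGrRing.eq_zero_of_sum_eq_zero (hGr : IsGrRing 𝒜) {ι : Type*} {s : Finset ι}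
    {d : ι → G} (hd : Function.Injective d) {a : ι → R} (ha : ∀ i ∈ s, a i ∈ 𝒜 (d i))
    (hsum : ∑ i ∈ s, a i = 0) {i : ι} (hi : i ∈ s) : a i = 0 := by
  let : DirectSum.Decomposition 𝒜 := hGr.internal.chooseDecomposition
  have h : ∑ k ∈ s, (DirectSum.decompose 𝒜 (a k) (d i) : R) = 0 := by
    have := congrArg (fun x => (DirectSum.decompose 𝒜 x (d i) : R)) hsum
    simpa [DirectSum.decompose_sum, DFinsupp.finsetSum_apply] using this
  rw [Finset.sum_eq_single_of_mem i hi fun k hk hki =>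
    DirectSum.decompose_of_mem_ne 𝒜 (ha k hk) (hd.ne hki),
    DirectSum.decompose_of_mem_same 𝒜 (ha i hi)] at h
  exact h

variable [IsDomain R]

/-- The degree-`g` component of an overring `S`: the fractions in `S` with homogeneous numerator
and denominator whose degrees differ by `g`. -/
def homComponent (hGr : IsGrRing 𝒜) (S : Subalgebra R (FractionRing R)) (g : G) :
    AddSubgroup S where
  carrier := {y | ∃ (j : G) (a b : R), a ∈ 𝒜 (g + j) ∧ b ∈ 𝒜 j ∧ b ≠ 0 ∧
    (y : FractionRing R) * algebraMap R (FractionRing R) b = algebraMap R (FractionRing R) a}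
  zero_mem' := ⟨0, 0, 1, zero_mem _, hGr.one_mem, one_ne_zero, by simp⟩
  add_mem' := by
    rintro x y ⟨j, a, b, ha, hb, hb0, hx⟩ ⟨k, a', b', ha', hb', hb0', hy⟩
    refine ⟨j + k, a * b' + a' * b, b * b', add_mem ?_ ?_, hGr.mul_mem hb hb',
      mul_ne_zero hb0 hb0', ?_⟩
    · rw [← add_assoc]
      exact hGr.mul_mem ha hb'
    · rw [add_comm j k, ← add_assoc]
      exact hGr.mul_mem ha' hb
    · simp only [map_add, map_mul, ← hx, ← hy, Subalgebra.coe_add]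
      ring
  neg_mem' := by
    rintro x ⟨j, a, b, ha, hb, hb0, hx⟩
    exact ⟨j, -a, b, neg_mem ha, hb, hb0, by simp [← hx]⟩

theorem isHomogeneousElem_homComponent_iff (hGr : IsGrRing 𝒜) {S : Subalgebra R (FractionRing R)}
    {y : S} : SetLike.IsHomogeneousElem (homComponent hGr S) y ↔
      IsHomFrac 𝒜 (y : FractionRing R) := by
  constructor
  · rintro ⟨g, j, a, b, ha, hb, hb0, h⟩
    exact ⟨_, _, a, b, ha, hb, hb0, h⟩
  · rintro ⟨i, j, a, b, ha, hb, hb0, h⟩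
    exact ⟨i - j, j, a, b, by simpa using ha, hb, hb0, h⟩

theorem gradedMonoid_homComponent (hGr : IsGrRing 𝒜) (S : Subalgebra R (FractionRing R)) :
    SetLike.GradedMonoid (homComponent hGr S) where
  one_mem := ⟨0, 1, 1, by simpa using hGr.one_mem, hGr.one_mem, one_ne_zero, by simp⟩
  mul_mem := by
    rintro g h x y ⟨j, a, b, ha, hb, hb0, hx⟩ ⟨k, a', b', ha', hb', hb0', hy⟩
    refine ⟨j + k, a * a', b * b', ?_, hGr.mul_mem hb hb', mul_ne_zero hb0 hb0', ?_⟩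
    · rw [add_add_add_comm]
      exact hGr.mul_mem ha ha'
    · simp only [map_mul, ← hx, ← hy, Subalgebra.coe_mul]
      ring

/-- Finitely many homogeneous fractions have a common homogeneous denominator. -/
theorem exists_common_denominator (hGr : IsGrRing 𝒜) {S : Subalgebra R (FractionRing R)}
    {x : G → S} (hx : ∀ g, x g ∈ homComponent hGr S g) (s : Finset G) :
    ∃ (d : G) (c : R), c ∈ 𝒜 d ∧ c ≠ 0 ∧ ∀ g ∈ s, ∃ a ∈ 𝒜 (g + d),
      (x g : FractionRing R) * algebraMap R (FractionRing R) c =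
        algebraMap R (FractionRing R) a := by
  induction s using Finset.induction_on with
  | empty => exact ⟨0, 1, hGr.one_mem, one_ne_zero, by simp⟩
  | insert k s _ ih =>
    obtain ⟨d, c, hc, hc0, h⟩ := ih
    obtain ⟨j, a, b, ha, hb, hb0, hab⟩ := hx k
    refine ⟨d + j, c * b, hGr.mul_mem hc hb, mul_ne_zero hc0 hb0, fun g hg => ?_⟩
    obtain rfl | hg := Finset.mem_insert.1 hg
    · refine ⟨a * c, ?_, ?_⟩
      · rw [add_comm d, ← add_assoc]
        exact hGr.mul_mem ha hc
      · rw [map_mul, map_mul, ← hab]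
        ring
    · obtain ⟨a', ha', h'⟩ := h g hg
      refine ⟨a' * b, ?_, ?_⟩
      · rw [← add_assoc]
        exact hGr.mul_mem ha' hb
      · rw [map_mul, map_mul, ← h']
        ring

theorem isInternal_homComponent (hGr : IsGrRing 𝒜) {S : Subalgebra R (FractionRing R)}
    (hS : IsGradedOverring 𝒜 S) : DirectSum.IsInternal (homComponent hGr S) := by
  classical
  constructor
  · rw [injective_iff_map_eq_zero]
    intro x hx
    rw [DirectSum.coeAddMonoidHom_eq_dfinsuppSum, DFinsupp.sum] at hx
    obtain ⟨d, c, -, hc0, hc⟩ :=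
      exists_common_denominator hGr (fun g => (x g).2) (DFinsupp.support x)
    choose! a ha hac using hc
    have hsum : ∑ g ∈ DFinsupp.support x, a g = 0 := by
      apply IsFractionRing.injective R (FractionRing R)
      rw [map_sum, map_zero, ← Finset.sum_congr rfl hac, ← Finset.sum_mul]
      have := congrArg (Subtype.val : S → FractionRing R) hx
      rw [AddSubmonoidClass.coe_finsetSum] at this
      rw [this]
      simp
    ext g
    by_cases hg : g ∈ DFinsupp.support x
    · have h0 := hac g hg
      rw [hGr.eq_zero_of_sum_eq_zero (add_left_injective d) ha hsum hg, map_zero] at h0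
      simpa [hc0] using h0
    · rw [DFinsupp.notMem_support_iff.1 hg]
      rfl
  · suffices h : ∀ x ∈ AddSubmonoid.closure {y : FractionRing R | y ∈ S ∧ IsHomFrac 𝒜 y},
        ∃ z, ((DirectSum.coeAddMonoidHom (homComponent hGr S) z : S) : FractionRing R) = x by
      intro x
      obtain ⟨z, hz⟩ := h x (hS x x.2)
      exact ⟨z, Subtype.ext hz⟩
    intro x hx
    induction hx using AddSubmonoid.closure_induction with
    | mem y hy =>
      obtain ⟨g, hg⟩ := (isHomogeneousElem_homComponent_iff hGr (y := ⟨y, hy.1⟩)).2 hy.2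
      exact ⟨DirectSum.of (fun g => homComponent hGr S g) g ⟨_, hg⟩, by simp⟩
    | zero => exact ⟨0, by simp⟩
    | add y z _ _ ihy ihz =>
      obtain ⟨u, rfl⟩ := ihy
      obtain ⟨v, rfl⟩ := ihz
      exact ⟨u + v, by simp⟩

/-- A height-one prime of a graded overring containing a nonzero homogeneous element is
homogeneous. -/
theorem HeightOnePrime.isHomIdealOver [IsAddTorsionFree G] (hGr : IsGrRing 𝒜)
    {S : Subalgebra R (FractionRing R)} (hS : IsGradedOverring 𝒜 S) {P : Ideal S}
    (hP : HeightOnePrime P) {x : S} (hx0 : x ≠ 0) (hxP : x ∈ P)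
    (hx : IsHomFrac 𝒜 (x : FractionRing R)) : IsHomIdealOver 𝒜 S P := by
  classical
  obtain ⟨o, rfl, _⟩ := exists_linearOrder_isOrderedCancelAddMonoid G
  let : DirectSum.Decomposition (homComponent hGr S) :=
    (isInternal_homComponent hGr hS).chooseDecomposition
  have : SetLike.GradedMonoid (homComponent hGr S) := gradedMonoid_homComponent hGr S
  let : GradedRing (homComponent hGr S) := { }
  have hhom : P.IsHomogeneous (homComponent hGr S) := by
    rw [Ideal.IsHomogeneous.iff_eq]
    by_contra hne
    have hbot := hP.2.2 _ (hP.1.homogeneousCore (𝒜 := homComponent hGr S))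
      (lt_of_le_of_ne (P.toIdeal_homogeneousCore_le _) hne)
    have hmem : x ∈ (P.homogeneousCore (homComponent hGr S)).toIdeal :=
      P.mem_homogeneousCore_of_homogeneous_of_mem
        ((isHomogeneousElem_homComponent_iff hGr).2 hx) hxP
    rw [hbot] at hmem
    exact hx0 hmem
  intro y hy
  rw [← DirectSum.sum_support_decompose (homComponent hGr S) y, AddSubmonoidClass.coe_finsetSum]
  exact sum_mem fun g _ => AddSubmonoid.subset_closure
    ⟨(isHomogeneousElem_homComponent_iff hGr).1 ⟨g, SetLike.coe_mem _⟩, Subtype.coe_prop _,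
      hhom g hy⟩

/-- In a Krull domain, an element outside every height-one prime is a unit. -/
theorem IsKrullDomainDef.isUnit_of_forall_notMem {A : Type*} [CommRing A] [IsDomain A]
    (hA : IsKrullDomainDef A) {x : A} (hx0 : x ≠ 0) (hx : ∀ P : Ideal A, HeightOnePrime P → x ∉ P) :
    IsUnit x := by
  have hx0' : algebraMap A (FractionRing A) x ≠ 0 := by simpa using hx0
  have hmem : (algebraMap A (FractionRing A) x)⁻¹ ∈
      ((⊥ : Subalgebra A (FractionRing A)) : Set (FractionRing A)) := by
    rw [hA.2.1]
    refine Set.mem_iInter₂.2 fun P hP => Algebra.subset_adjoin ⟨1, x, hx P hP, ?_⟩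
    rw [inv_mul_cancel₀ hx0', map_one]
  obtain ⟨y, hy⟩ := Algebra.mem_bot.1 hmem
  refine IsUnit.of_mul_eq_one y (IsFractionRing.injective A (FractionRing A) ?_)
  rw [map_mul, hy, mul_inv_cancel₀ hx0', map_one]

end Helpers

/-- Let `R` be a `G`-graded gr-(R₁) domain whose integral closure `R′` is a
(graded) Krull domain and such that height-one homogeneous primes of `R′` contract to
height-one homogeneous primes of `R`. If some graded maximal ideal `𝔪` of `R` contains every
height-one homogeneous prime of `R`, then `R` is gr-local. -/
theorem grLocal_of_heightOne_le_grMax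
    {G : Type*} [DecidableEq G] [AddCommGroup G] (hG : ∀ g : G, g ≠ 0 → ¬IsOfFinAddOrder g)
    {R : Type*} [CommRing R] [IsDomain R]
    (𝒜 : G → AddSubgroup R) (hGr : IsGrRing 𝒜) (hR1 : GrR1 𝒜)
    (hKrull : IsKrullDomainDef (integralClosure R (FractionRing R)))
    (hgradedIC : IsGradedOverring 𝒜 (integralClosure R (FractionRing R)))
    (hcontr : ∀ P : Ideal (integralClosure R (FractionRing R)),
      HeightOnePrime P → IsHomIdealOver 𝒜 (integralClosure R (FractionRing R)) P →
      HeightOnePrime (P.comap (algebraMap R (integralClosure R (FractionRing R)))) ∧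
      IsHomIdeal 𝒜 (P.comap (algebraMap R (integralClosure R (FractionRing R)))))
    (h𝔪 : ∃ 𝔪 : Ideal R, IsGrMaxIdeal 𝒜 𝔪 ∧
      ∀ 𝔭 : Ideal R, HeightOnePrime 𝔭 → IsHomIdeal 𝒜 𝔭 → 𝔭 ≤ 𝔪) :
    GrLocal 𝒜 := by
  obtain ⟨𝔪, h𝔪max, hle⟩ := h𝔪
  have : IsAddTorsionFree G := by
    refine ⟨fun n hn x y hxy => ?_⟩
    by_contra hne
    refine hG (x - y) (sub_ne_zero.2 hne) (isOfFinAddOrder_iff_nsmul_eq_zero.2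
      ⟨n, Nat.pos_of_ne_zero hn, ?_⟩)
    rw [nsmul_sub, sub_eq_zero]
    exact hxy
  have hunit : ∀ x : R, SetLike.IsHomogeneousElem 𝒜 x → x ∉ 𝔪 → IsUnit x := by
    rintro x ⟨i, hi⟩ hx
    have hx0 : x ≠ 0 := by
      rintro rfl
      exact hx (zero_mem _)
    have hx0' : algebraMap R (integralClosure R (FractionRing R)) x ≠ 0 := by
      simpa using hx0
    refine isUnit_of_map_unit (algebraMap R (integralClosure R (FractionRing R))) x
      (hKrull.isUnit_of_forall_notMem hx0' fun P hP hxP => hx ?_)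
    have hPhom := hP.isHomIdealOver hGr hgradedIC hx0' hxP
      ⟨i, 0, x, 1, hi, hGr.one_mem, one_ne_zero, by simp⟩
    obtain ⟨h1, h2⟩ := hcontr P hP hPhom
    exact hle _ h1 h2 hxP
  refine ⟨𝔪, h𝔪max, fun 𝔫 h𝔫 => (h𝔫.2.2 𝔪 h𝔪max.1 (fun x hx => ?_) h𝔪max.2.1).symm⟩
  refine (AddSubmonoid.closure_le (S := 𝔪.toAddSubmonoid)).2 ?_ (h𝔫.1 x hx)
  rintro y ⟨hy, hy𝔫⟩
  by_contra hy𝔪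
  exact h𝔫.2.1 (Ideal.eq_top_of_isUnit_mem _ hy𝔫 (hunit y hy hy𝔪))
end
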